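/- Let p ≥ 1 and ψ ∈ C_{b,p}(ℝ^d). Then for every y ∈ ℝ^d, the increasing convex hull of ψ satisfies iconv ψ(y) = inf { ∫ψ dρ : ρ ∈ P_p(ℝ^d), δ_y ≼_icx ρ }, where δ_y is the Dirac measure at y. -/

import Mathlib

open MeasureTheory Set Filter Topology
open scoped ENNReal

noncomputable section

/-- `ℝ^d`, modelled as Euclidean space. -/
abbrev Rd (d : ℕ) : Type := EuclideanSpace ℝ (Fin d)

/-- A Borel measure on `ℝ^d` has finite `p`-th moment. -/
def HasMomentP (p : ℝ) {d : ℕ} (ρ : Measure (Rd d)) : Prop :=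
  ∫⁻ y, ENNReal.ofReal (‖y‖ ^ p) ∂ρ ≠ ⊤

/-- `P_p(ℝ^d)`: Borel probability measures on `ℝ^d` with finite `p`-th moment. -/
abbrev Pp (p : ℝ) (d : ℕ) : Type :=
  {ρ : Measure (Rd d) // IsProbabilityMeasure ρ ∧ HasMomentP p ρ}

/-- Continuous test functions of growth of order at most `p`. -/
def GrowthP (p : ℝ) {d : ℕ} (f : Rd d → ℝ) : Prop :=
  Continuous f ∧ ∃ K : ℝ, ∀ y, |f y| ≤ K * (1 + ‖y‖ ^ p)

/-- The `p`-weak topology on `P_p(ℝ^d)`: the initial topology induced by integration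
against continuous functions of growth of order at most `p`. -/
instance PpTopology (p : ℝ) (d : ℕ) : TopologicalSpace (Pp p d) :=
  ⨅ f : {f : Rd d → ℝ // GrowthP p f},
    TopologicalSpace.induced (fun ρ : Pp p d => ∫ y, f.1 y ∂ρ.1) inferInstance

instance PpMeasurableSpace (p : ℝ) (d : ℕ) : MeasurableSpace (Pp p d) := borel _

/-- `C_{b,p}(ℝ^d)`: continuous functions bounded from below by a constant and bounded
above by `K (1 + |y - y₀|^p)` for some `K > 0`, `y₀`. -/
def Cbp (p : ℝ) {d : ℕ} (ψ : Rd d → ℝ) : Prop :=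
  Continuous ψ ∧ (∃ c : ℝ, ∀ y, c ≤ ψ y) ∧
    ∃ K : ℝ, 0 < K ∧ ∃ y₀ : Rd d, ∀ y, ψ y ≤ K * (1 + ‖y - y₀‖ ^ p)

open scoped Classical in
/-- The nonnegative part of an extended real, as an extended nonnegative real. -/
def erealToENN (x : EReal) : ℝ≥0∞ := if x = ⊤ then ⊤ else ENNReal.ofReal x.toReal

/-- Canonical extended integral of an `EReal`-valued function: the lower integral of the
positive part minus the lower integral of the negative part. -/
def eInt {α : Type*} [MeasurableSpace α] (μ : Measure α) (f : α → EReal) : EReal :=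
  ((∫⁻ x, erealToENN (f x) ∂μ : ℝ≥0∞) : EReal) -
    ((∫⁻ x, erealToENN (-(f x)) ∂μ : ℝ≥0∞) : EReal)

/-- The convex order on measures on `ℝ^d`: `ρ₁ ≼_c ρ₂` iff `∫ f dρ₁ ≤ ∫ f dρ₂` for every
convex function `f : ℝ^d → ℝ` (integrals taken in the extended sense). -/
def ConvexOrder {d : ℕ} (ρ₁ ρ₂ : Measure (Rd d)) : Prop :=
  ∀ f : Rd d → ℝ, ConvexOn ℝ univ f →
    eInt ρ₁ (fun y => (f y : EReal)) ≤ eInt ρ₂ (fun y => (f y : EReal))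

/-- Coordinatewise increasing functions on `ℝ^d`. -/
def CoordMono {d : ℕ} (f : Rd d → ℝ) : Prop :=
  ∀ y z : Rd d, (∀ i, y i ≤ z i) → f y ≤ f z

/-- The increasing convex order on measures on `ℝ^d`. -/
def IcxOrder {d : ℕ} (ρ₁ ρ₂ : Measure (Rd d)) : Prop :=
  ∀ f : Rd d → ℝ, ConvexOn ℝ univ f → CoordMono f →
    eInt ρ₁ (fun y => (f y : EReal)) ≤ eInt ρ₂ (fun y => (f y : EReal))

/-- `π` is a coupling of `μ` and `ν`. -/
def IsCoupling {X Y : Type*} [MeasurableSpace X] [MeasurableSpace Y]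
    (π : Measure (X × Y)) (μ : Measure X) (ν : Measure Y) : Prop :=
  IsProbabilityMeasure π ∧ π.map Prod.fst = μ ∧ π.map Prod.snd = ν

open scoped Classical in
/-- Disintegration of a measure on a product space with respect to its first marginal. -/
def disint {X : Type*} [MeasurableSpace X] {Y : Type*} [MeasurableSpace Y]
    [StandardBorelSpace Y] [Nonempty Y] (π : Measure (X × Y)) :
    ProbabilityTheory.Kernel X Y :=
  if h : IsFiniteMeasure π then (haveI := h; π.condKernel) else 0

/-- The primal weak optimal transport value `inf_{π ∈ Π(μ,ν)} ∫ C(x, π_x) dμ(x)`. -/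
def primal {X : Type*} [MeasurableSpace X] {d : ℕ}
    (μ : Measure X) (ν : Measure (Rd d)) (C : X → Measure (Rd d) → ℝ≥0∞) : ℝ≥0∞ :=
  ⨅ π : {π : Measure (X × Rd d) // IsCoupling π μ ν}, ∫⁻ x, C x (disint π.1 x) ∂μ

/-- The `C`-conjugate `ψ^C (x) = inf_{ρ ∈ P_p} ρ(ψ) + C(x, ρ)`. -/
def conj (p : ℝ) {X : Type*} [MeasurableSpace X] {d : ℕ}
    (C : X → Measure (Rd d) → ℝ≥0∞) (ψ : Rd d → ℝ) (x : X) : EReal :=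
  ⨅ ρ : Pp p d, ((∫ y, ψ y ∂ρ.1 : ℝ) : EReal) + ((C x ρ.1 : ℝ≥0∞) : EReal)

/-- The dual value `μ(ψ^C) - ν(ψ)`. -/
def dualVal (p : ℝ) {X : Type*} [MeasurableSpace X] {d : ℕ}
    (μ : Measure X) (ν : Measure (Rd d)) (C : X → Measure (Rd d) → ℝ≥0∞)
    (ψ : Rd d → ℝ) : EReal :=
  eInt μ (conj p C ψ) - ((∫ y, ψ y ∂ν : ℝ) : EReal)

end

theorem eInt_coe {d : ℕ} (ρ : Measure (Rd d)) (f : Rd d → ℝ) :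
    eInt ρ (fun y => (f y : EReal)) =
      ((∫⁻ x, ENNReal.ofReal (f x) ∂ρ : ℝ≥0∞) : EReal) -
        ((∫⁻ x, ENNReal.ofReal (-f x) ∂ρ : ℝ≥0∞) : EReal) := by
  simp only [eInt, erealToENN, ← EReal.coe_neg, EReal.coe_ne_top, if_false, EReal.toReal_coe]

theorem coe_ofReal_sub_coe_ofReal_neg (r : ℝ) :
    ((ENNReal.ofReal r : ℝ≥0∞) : EReal) - ((ENNReal.ofReal (-r) : ℝ≥0∞) : EReal) = r := by
  rw [EReal.coe_ennreal_ofReal, EReal.coe_ennreal_ofReal, ← EReal.coe_sub,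
    max_zero_sub_max_neg_zero_eq_self]

theorem eInt_dirac {d : ℕ} (z : Rd d) (f : Rd d → ℝ) :
    eInt (Measure.dirac z) (fun y => (f y : EReal)) = f z := by
  rw [eInt_coe, lintegral_dirac, lintegral_dirac, coe_ofReal_sub_coe_ofReal_neg]

theorem eInt_eq_integral {d : ℕ} {ρ : Measure (Rd d)} {f : Rd d → ℝ} (hf : Integrable f ρ) :
    eInt ρ (fun y => (f y : EReal)) = ((∫ y, f y ∂ρ : ℝ) : EReal) := by
  have hN : ∫⁻ x, ENNReal.ofReal (-f x) ∂ρ ≠ ⊤ := hf.neg.lintegral_lt_top.ne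
  rw [eInt_coe, integral_eq_lintegral_pos_part_sub_lintegral_neg_part hf, EReal.coe_sub,
    EReal.coe_ennreal_toReal hf.lintegral_lt_top.ne, EReal.coe_ennreal_toReal hN]

theorem eInt_mono {d : ℕ} {ρ : Measure (Rd d)} {f g : Rd d → ℝ} (h : ∀ z, f z ≤ g z) :
    eInt ρ (fun y => (f y : EReal)) ≤ eInt ρ (fun y => (g y : EReal)) := by
  rw [eInt_coe, eInt_coe]
  refine EReal.sub_le_sub ?_ ?_ <;> rw [EReal.coe_ennreal_le_coe_ennreal_iff] <;>
    refine lintegral_mono fun x => ENNReal.ofReal_le_ofReal ?_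
  · exact h x
  · exact neg_le_neg (h x)

theorem ne_top_of_coe_le_sub {r : ℝ} {P N : ℝ≥0∞} (h : (r : EReal) ≤ (P : EReal) - (N : EReal)) :
    N ≠ ⊤ := by
  rintro rfl
  rw [EReal.coe_ennreal_top, EReal.sub_top] at h
  exact EReal.coe_ne_bot r (le_bot_iff.mp h)

theorem coe_combo_le_combo_sub_combo {a b r s : ℝ} (ha : 0 < a) (hb : 0 < b) {P N Q M : ℝ≥0∞}
    (h₁ : (r : EReal) ≤ (P : EReal) - (N : EReal)) (h₂ : (s : EReal) ≤ (Q : EReal) - (M : EReal)) :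
    ((a * r + b * s : ℝ) : EReal) ≤
      ((ENNReal.ofReal a * P + ENNReal.ofReal b * Q : ℝ≥0∞) : EReal) -
        ((ENNReal.ofReal a * N + ENNReal.ofReal b * M : ℝ≥0∞) : EReal) := by
  have hN := ne_top_of_coe_le_sub h₁
  have hM := ne_top_of_coe_le_sub h₂
  have hNM : ENNReal.ofReal a * N + ENNReal.ofReal b * M ≠ ⊤ := by finiteness
  by_cases hPQ : ENNReal.ofReal a * P + ENNReal.ofReal b * Q = ⊤
  · rw [hPQ, ← EReal.coe_ennreal_toReal hNM, EReal.coe_ennreal_top, EReal.top_sub_coe]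
    exact le_top
  · have hP : P ≠ ⊤ := by
      rintro rfl
      simp [ENNReal.mul_top, ha] at hPQ
    have hQ : Q ≠ ⊤ := by
      rintro rfl
      simp [ENNReal.mul_top, hb] at hPQ
    rw [← EReal.coe_ennreal_toReal hP, ← EReal.coe_ennreal_toReal hN,
      ← EReal.coe_sub, EReal.coe_le_coe_iff] at h₁
    rw [← EReal.coe_ennreal_toReal hQ, ← EReal.coe_ennreal_toReal hM,
      ← EReal.coe_sub, EReal.coe_le_coe_iff] at h₂
    rw [← EReal.coe_ennreal_toReal hPQ, ← EReal.coe_ennreal_toReal hNM,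
      ← EReal.coe_sub, EReal.coe_le_coe_iff,
      ENNReal.toReal_add (by finiteness) (by finiteness),
      ENNReal.toReal_add (by finiteness) (by finiteness)]
    simp only [ENNReal.toReal_mul, ENNReal.toReal_ofReal ha.le, ENNReal.toReal_ofReal hb.le]
    nlinarith [mul_le_mul_of_nonneg_left h₁ ha.le, mul_le_mul_of_nonneg_left h₂ hb.le]

theorem IcxOrder.dirac_combo {d : ℕ} {z w : Rd d} {ρ σ : Measure (Rd d)}
    (hρ : IcxOrder (Measure.dirac z) ρ) (hσ : IcxOrder (Measure.dirac w) σ)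
    {a b : ℝ} (ha : 0 < a) (hb : 0 < b) (hab : a + b = 1) :
    IcxOrder (Measure.dirac (a • z + b • w)) (ENNReal.ofReal a • ρ + ENNReal.ofReal b • σ) := by
  intro f hf hmono
  have h₁ := hρ f hf hmono
  have h₂ := hσ f hf hmono
  rw [eInt_dirac, eInt_coe] at h₁ h₂
  rw [eInt_dirac, eInt_coe]
  simp only [lintegral_add_measure, lintegral_smul_measure, smul_eq_mul]
  refine le_trans ?_ (coe_combo_le_combo_sub_combo ha hb h₁ h₂)
  exact EReal.coe_le_coe_iff.mpr (hf.2 (mem_univ z) (mem_univ w) ha.le hb.le hab)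

theorem IcxOrder.dirac_of_le {d : ℕ} {z w : Rd d} (hzw : ∀ i, z i ≤ w i) {ρ : Measure (Rd d)}
    (hρ : IcxOrder (Measure.dirac w) ρ) : IcxOrder (Measure.dirac z) ρ := by
  intro f hf hmono
  refine le_trans ?_ (hρ f hf hmono)
  rw [eInt_dirac, eInt_dirac]
  exact EReal.coe_le_coe_iff.mpr (hmono z w hzw)

theorem Cbp.integrable {d : ℕ} {p : ℝ} (hp : 1 ≤ p) {ψ : Rd d → ℝ} (hψ : Cbp p ψ) (ρ : Pp p d) :
    Integrable ψ ρ.1 := by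
  obtain ⟨hcont, ⟨c, hc⟩, K, hK, y₀, hle⟩ := hψ
  obtain ⟨ρ, hprob, hmom⟩ := ρ
  have hp₀ : 0 < p := by linarith
  have hcontp : Continuous fun z : Rd d => ‖z‖ ^ p :=
    continuous_norm.rpow_const fun _ => Or.inr hp₀.le
  have hint : Integrable (fun z : Rd d => ‖z‖ ^ p) ρ := by
    refine ⟨hcontp.aestronglyMeasurable, ?_⟩
    rw [hasFiniteIntegral_iff_ofReal (ae_of_all _ fun z => by positivity)]
    exact lt_top_iff_ne_top.mpr hmom
  have hq₀ : ENNReal.ofReal p ≠ 0 := by simpa using hp₀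
  have hq : (ENNReal.ofReal p).toReal = p := ENNReal.toReal_ofReal hp₀.le
  have hid : MemLp (fun z : Rd d => z) (ENNReal.ofReal p) ρ := by
    rw [← integrable_norm_rpow_iff (f := fun z : Rd d => z)
      continuous_id.aestronglyMeasurable hq₀ ENNReal.ofReal_ne_top, hq]
    exact hint
  have hshift : Integrable (fun z : Rd d => ‖z - y₀‖ ^ p) ρ := by
    have := (hid.sub (memLp_const y₀)).integrable_norm_rpow hq₀ ENNReal.ofReal_ne_top
    rwa [hq] at this
  refine (((integrable_const 1).add hshift).const_mul K |>.add (integrable_const |c|)).mono'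
    hcont.aestronglyMeasurable (ae_of_all _ fun z => ?_)
  have hpos : 0 ≤ K * (1 + ‖z - y₀‖ ^ p) := by positivity
  simp only [Pi.add_apply]
  rw [Real.norm_eq_abs, abs_le]
  constructor <;> linarith [hc z, hle z, neg_abs_le c, abs_nonneg c]

/-- The mixture `a ρ + b σ` of two measures in `P_p(ℝ^d)`. -/
noncomputable def Pp.combo {p : ℝ} {d : ℕ} (ρ σ : Pp p d) {a b : ℝ} (ha : 0 ≤ a) (hb : 0 ≤ b)
    (hab : a + b = 1) : Pp p d :=
  ⟨ENNReal.ofReal a • ρ.1 + ENNReal.ofReal b • σ.1, by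
    have := ρ.2.1
    have := σ.2.1
    refine ⟨⟨?_⟩, ?_⟩
    · simp [← ENNReal.ofReal_add ha hb, hab]
    · have := ρ.2.2
      have := σ.2.2
      simp only [HasMomentP, lintegral_add_measure, lintegral_smul_measure, smul_eq_mul] at *
      finiteness⟩

/-- The Dirac measure as an element of `P_p(ℝ^d)`. -/
noncomputable def Pp.dirac (p : ℝ) {d : ℕ} (z : Rd d) : Pp p d :=
  ⟨Measure.dirac z, inferInstance, by simp [HasMomentP]⟩

/-- The infimum of `∫ ψ dρ` over the `ρ ∈ P_p(ℝ^d)` with `δ_z ≼_icx ρ`. -/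
noncomputable def icxInf (p : ℝ) {d : ℕ} (ψ : Rd d → ℝ) (z : Rd d) : ℝ :=
  ⨅ ρ : {ρ : Pp p d // IcxOrder (Measure.dirac z) ρ.1}, ∫ x, ψ x ∂ρ.1.1

instance nonempty_icxOrder_dirac (p : ℝ) {d : ℕ} (z : Rd d) :
    Nonempty {ρ : Pp p d // IcxOrder (Measure.dirac z) ρ.1} :=
  ⟨⟨Pp.dirac p z, fun _ _ _ => le_rfl⟩⟩

section icxInf

variable {d : ℕ} {p : ℝ} {ψ : Rd d → ℝ}

theorem icxInf_le (hp : 1 ≤ p) (hψ : Cbp p ψ) {z : Rd d} {ρ : Pp p d}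
    (hρ : IcxOrder (Measure.dirac z) ρ.1) : icxInf p ψ z ≤ ∫ x, ψ x ∂ρ.1 := by
  obtain ⟨c, hc⟩ := hψ.2.1
  refine ciInf_le (f := fun ρ : {ρ : Pp p d // IcxOrder (Measure.dirac z) ρ.1} =>
    ∫ x, ψ x ∂ρ.1.1) ⟨c, ?_⟩ ⟨ρ, hρ⟩
  rintro _ ⟨σ, rfl⟩
  have := σ.1.2.1
  simpa using integral_mono (integrable_const c) (hψ.integrable hp σ.1) hc

theorem exists_integral_lt_of_icxInf_lt {z : Rd d} {r : ℝ} (h : icxInf p ψ z < r) :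
    ∃ ρ : Pp p d, IcxOrder (Measure.dirac z) ρ.1 ∧ ∫ x, ψ x ∂ρ.1 < r := by
  obtain ⟨ρ, hρ⟩ := exists_lt_of_ciInf_lt h
  exact ⟨ρ.1, ρ.2, hρ⟩

theorem icxInf_le_self (hp : 1 ≤ p) (hψ : Cbp p ψ) (z : Rd d) : icxInf p ψ z ≤ ψ z := by
  have h := icxInf_le hp hψ (ρ := Pp.dirac p z) fun _ _ _ => le_rfl
  rwa [Pp.dirac, integral_dirac] at h

theorem coordMono_icxInf (hp : 1 ≤ p) (hψ : Cbp p ψ) : CoordMono (icxInf p ψ) := fun _ _ hzw =>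
  le_ciInf fun ρ => icxInf_le hp hψ (ρ.2.dirac_of_le hzw)

theorem convexOn_icxInf (hp : 1 ≤ p) (hψ : Cbp p ψ) : ConvexOn ℝ univ (icxInf p ψ) := by
  refine convexOn_iff_forall_pos.mpr ⟨convex_univ, fun z _ w _ a b ha hb hab => ?_⟩
  refine le_of_forall_pos_le_add fun ε hε => ?_
  obtain ⟨ρ, hρ, hρε⟩ := exists_integral_lt_of_icxInf_lt (lt_add_of_pos_right (icxInf p ψ z) hε)
  obtain ⟨σ, hσ, hσε⟩ := exists_integral_lt_of_icxInf_lt (lt_add_of_pos_right (icxInf p ψ w) hε)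
  have h := icxInf_le hp hψ (ρ := ρ.combo σ ha.le hb.le hab) (hρ.dirac_combo hσ ha hb hab)
  rw [Pp.combo, integral_add_measure
    ((hψ.integrable hp ρ).smul_measure ENNReal.ofReal_ne_top)
    ((hψ.integrable hp σ).smul_measure ENNReal.ofReal_ne_top),
    integral_smul_measure, integral_smul_measure, ENNReal.toReal_ofReal ha.le,
    ENNReal.toReal_ofReal hb.le] at h
  simp only [smul_eq_mul] at h ⊢
  have hε' : a * ε + b * ε = ε := by rw [← add_mul, hab, one_mul]
  linarith [mul_le_mul_of_nonneg_left hρε.le ha.le, mul_le_mul_of_nonneg_left hσε.le hb.le]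

end icxInf

/-- **Representation of the increasing convex hull** (Lemma 2 (ii)): for `ψ ∈ C_{b,p}(ℝ^d)`,
`iconv ψ (y) = inf { ρ(ψ) : ρ ∈ P_p(ℝ^d), δ_y ≼_icx ρ }`. -/
theorem increasingConvexHull_eq_inf_over_icxOrder
    {d : ℕ} {p : ℝ} (hp : 1 ≤ p) (ψ : Rd d → ℝ) (hψ : Cbp p ψ) (y : Rd d) :
    (⨆ φ : {φ : Rd d → ℝ // (ConvexOn ℝ Set.univ φ ∧ CoordMono φ) ∧ ∀ z, φ z ≤ ψ z},
        (φ.1 y : EReal))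
      = ⨅ ρ : {ρ : Pp p d // IcxOrder (Measure.dirac y) ρ.1},
          ((∫ z, ψ z ∂ρ.1.1 : ℝ) : EReal) := by
  apply le_antisymm
  · refine iSup_le fun φ => le_iInf fun ρ => ?_
    rw [← eInt_dirac y φ.1, ← eInt_eq_integral (hψ.integrable hp ρ.1)]
    exact (ρ.2 φ.1 φ.2.1.1 φ.2.1.2).trans (eInt_mono φ.2.2)
  · refine le_trans (b := (icxInf p ψ y : EReal)) ?_ ?_
    · refine EReal.le_of_forall_lt_iff_le.mp fun r hr => ?_
      obtain ⟨ρ, hρ, hρr⟩ := exists_integral_lt_of_icxInf_lt (EReal.coe_lt_coe_iff.mp hr)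
      exact (iInf_le _ ⟨ρ, hρ⟩).trans (EReal.coe_le_coe_iff.mpr hρr.le)
    · exact le_iSup (fun φ : {φ : Rd d → ℝ //
        (ConvexOn ℝ Set.univ φ ∧ CoordMono φ) ∧ ∀ z, φ z ≤ ψ z} => (φ.1 y : EReal))
        ⟨icxInf p ψ, ⟨convexOn_icxInf hp hψ, coordMono_icxInf hp hψ⟩, icxInf_le_self hp hψ⟩
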